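/- Let P be a central p-subgroup of the finite group G. Then I_{≤P}(G) · J(Z(FG)) = I_{≤P}(G) · J(FP), where both products are taken inside the group algebra FG and J(FP) is the Jacobson radical (augmentation ideal) of the group algebra FP of the central subgroup P. -/

import Mathlib

set_option synthInstance.maxHeartbeats 1000000
set_option maxHeartbeats 1000000

open scoped Classical

/-- The class sum `K⁺ = ∑_{x ∈ K} x` of a conjugacy class `K` in the group algebra `FG`. -/
noncomputable def classSum (F : Type) [Field F] {G : Type} [Group G] [Fintype G]
    (K : ConjClasses G) : MonoidAlgebra F G :=
  ∑ x : G, if x ∈ K.carrier then MonoidAlgebra.single x (1 : F) else 0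

/-- `P` is a defect group of the conjugacy class `K`: `P` is a Sylow `p`-subgroup of the
centralizer of some element of `K`. -/
def IsClassDefectGroup {G : Type} [Group G] (p : ℕ) (P : Subgroup G) (K : ConjClasses G) : Prop :=
  ∃ x ∈ K.carrier, ∃ S : Sylow p ↥(Subgroup.centralizer {x}),
    P = Subgroup.map (Subgroup.centralizer {x}).subtype S.toSubgroup

/-- `I_P(G)`: the `F`-span of the class sums of conjugacy classes with defect group `P`. -/
noncomputable def classIdeal (F : Type) [Field F] {G : Type} [Group G] [Fintype G]
    (p : ℕ) (P : Subgroup G) : Submodule F (MonoidAlgebra F G) :=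
  Submodule.span F {a | ∃ K : ConjClasses G, IsClassDefectGroup p P K ∧ a = classSum F K}

/-- `I_{≤P}(G) = ∑_{Q ≤ P} I_Q(G)`. -/
noncomputable def classIdealLE (F : Type) [Field F] {G : Type} [Group G] [Fintype G]
    (p : ℕ) (P : Subgroup G) : Submodule F (MonoidAlgebra F G) :=
  ⨆ Q ≤ P, classIdeal F p Q

/-- `I_{<P}(G) = ∑_{Q < P} I_Q(G)`. -/
noncomputable def classIdealLT (F : Type) [Field F] {G : Type} [Group G] [Fintype G]
    (p : ℕ) (P : Subgroup G) : Submodule F (MonoidAlgebra F G) :=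
  ⨆ Q < P, classIdeal F p Q

/-- The Jacobson radical `J(Z(FG))` of the center of the group algebra, viewed as an
`F`-submodule of `FG`. -/
noncomputable def JZ (F : Type) [Field F] (G : Type) [Group G] [Fintype G] :
    Submodule F (MonoidAlgebra F G) :=
  Submodule.map (Subalgebra.center F (MonoidAlgebra F G)).val.toLinearMap
    ((Ideal.jacobson (⊥ : Ideal ↥(Subalgebra.center F (MonoidAlgebra F G)))).restrictScalars F)

section PassmanLemma

open MonoidAlgebra

variable {F : Type} [Field F] {G : Type} [Group G]

lemma le_centralizer_of_le_center {P : Subgroup G} (hP : P ≤ Subgroup.center G) (s : Set G) :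
    P ≤ Subgroup.centralizer s :=
  hP.trans (Subgroup.center_le_centralizer s)

lemma normal_of_le_center {P : Subgroup G} (hP : P ≤ Subgroup.center G) : P.Normal :=
  ⟨fun u hu g => by rw [Subgroup.mem_center_iff.1 (hP hu) g]; simpa using hu⟩

lemma eq_of_coprime_orderOf_of_mk_eq {p : ℕ} {P : Subgroup G}
    (hP : IsPGroup p P) (hc : P ≤ Subgroup.center G) {r s : G}
    (hr : (orderOf r).Coprime p) (hs : (orderOf s).Coprime p)
    (h : (r : G ⧸ P) = s) : r = s := by
  have hu := QuotientGroup.eq.1 h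
  set u := r⁻¹ * s with hu'
  have hsu : s = r * u := by simp [hu']
  have hcomm : Commute r u := Subgroup.mem_center_iff.1 (hc hu) r
  obtain ⟨k, hk⟩ := hP ⟨u, hu⟩
  have hk' : u ^ p ^ k = 1 := by simpa [Subtype.ext_iff] using hk
  have hN : u ^ (orderOf r * orderOf s) = 1 := by
    have h1 : s ^ (orderOf r * orderOf s) = 1 := by
      rw [mul_comm, pow_mul, pow_orderOf_eq_one, one_pow]
    rwa [hsu, hcomm.mul_pow, ← hsu, pow_mul r, pow_orderOf_eq_one, one_pow, one_mul] at h1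
  have hcop : (orderOf r * orderOf s).Coprime (p ^ k) := (hr.mul_left hs).pow_right k
  have : u = 1 := by
    rw [← orderOf_eq_one_iff]
    exact Nat.eq_one_of_dvd_coprimes hcop (orderOf_dvd_of_pow_eq_one hN)
      (orderOf_dvd_of_pow_eq_one hk')
  simp [hsu, this]

lemma mem_jacobson_bot_of_isNilpotent_of_commute {R : Type*} [Ring R] {x : R}
    (hx : IsNilpotent x) (hc : ∀ y, Commute y x) : x ∈ Ideal.jacobson (⊥ : Ideal R) := by
  rw [Ideal.mem_jacobson_iff]
  intro y
  obtain ⟨v, hv⟩ := ((hc y).isNilpotent_mul_left hx).isUnit_add_one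
  refine ⟨↑v⁻¹, ?_⟩
  have h := v.inv_mul
  rw [hv, mul_add, mul_one, ← mul_assoc] at h
  rw [h, sub_self]
  exact Ideal.zero_mem _

lemma isNilpotent_of_mem_jacobson_bot {R : Type*} [Ring R] [IsArtinianRing R] {x : R}
    (hx : x ∈ Ideal.jacobson (⊥ : Ideal R)) : IsNilpotent x := by
  obtain ⟨n, hn⟩ := IsArtinianRing.isNilpotent_jacobson_bot (R := R)
  refine ⟨n, ?_⟩
  have := Ideal.pow_mem_pow hx n
  rwa [hn] at this

lemma isClassDefectGroup_mk_of_not_dvd_relIndex {p : ℕ} [Fact p.Prime] {P : Subgroup G}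
    (hP : IsPGroup p P) (hc : P ≤ Subgroup.center G) {x : G}
    (h : ¬ p ∣ P.relIndex (Subgroup.centralizer {x})) :
    IsClassDefectGroup p P (ConjClasses.mk x) := by
  have hp : IsPGroup p (P.subgroupOf (Subgroup.centralizer {x})) :=
    hP.comap_of_injective _ (Subgroup.subtype_injective _)
  exact ⟨x, ConjClasses.mem_carrier_mk, hp.toSylow h,
    (Subgroup.map_subgroupOf_eq_of_le (le_centralizer_of_le_center hc {x})).symm⟩

lemma one_sub_single_mem_jacobson {p : ℕ} [Fact p.Prime] [CharP F p] {P : Subgroup G}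
    (hP : IsPGroup p P) (hc : P ≤ Subgroup.center G) (u : P) :
    (1 - single u 1 : MonoidAlgebra F P) ∈ Ideal.jacobson (⊥ : Ideal (MonoidAlgebra F P)) := by
  have hcomm : ∀ y : MonoidAlgebra F P, Commute y (single u 1) := fun y =>
    (single_commute (fun v => Subtype.ext (Subgroup.mem_center_iff.1 (hc u.2) v).symm)
      (fun r => Commute.one_left r) y).symm
  refine mem_jacobson_bot_of_isNilpotent_of_commute ?_ fun y =>
    (Commute.one_right y).sub_right (hcomm y)
  obtain ⟨k, hk⟩ := hP u
  have : CharP (MonoidAlgebra F P) p := charP_of_injective_algebraMap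
    (FaithfulSMul.algebraMap_injective F (MonoidAlgebra F P)) p
  refine ⟨p ^ k, ?_⟩
  rw [sub_pow_char_pow_of_commute _ _ (Commute.one_left _), one_pow, single_pow, hk, one_pow,
    one_def, sub_self]

variable [Fintype G]

/-- In a finite group algebra, the sum of all conjugates of `a` vanishes when `a` is
nilpotent. -/
lemma sum_conj_eq_zero_of_isNilpotent {a : MonoidAlgebra F G} (ha : IsNilpotent a) :
    ∑ g : G, single g (1 : F) * a * single g⁻¹ 1 = 0 := by
  ext y
  let L : Module.End F (MonoidAlgebra F G) :=
    LinearMap.mulLeft F a * LinearMap.mulRight F (single y⁻¹ 1)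
  have hL : IsNilpotent L := by
    refine Commute.isNilpotent_mul_right (LinearMap.commute_mulLeft_right _ _) ?_
    exact ha.map (Algebra.lmul F (MonoidAlgebra F G))
  have htr : LinearMap.trace F _ L = 0 :=
    (LinearMap.isNilpotent_trace_of_isNilpotent hL).eq_zero
  rw [LinearMap.trace_eq_matrix_trace F (MonoidAlgebra.basis G F)] at htr
  rw [← Equiv.sum_comp (Equiv.inv G), coeff_zero, Finsupp.zero_apply, ← htr]
  simp [Matrix.trace, LinearMap.toMatrix_apply, L, coeff_sum, MonoidAlgebra.basis, mul_assoc]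

/-- The relative trace map `a ↦ ∑_{q ∈ G/P} q a q⁻¹`, over a fixed transversal of `G/P`. -/
noncomputable def relTrace (F : Type) [Field F] (P : Subgroup G) :
    MonoidAlgebra F G →ₗ[F] MonoidAlgebra F G :=
  ∑ q : G ⧸ P, LinearMap.mulLeft F (single q.out (1 : F)) ∘ₗ
    LinearMap.mulRight F (single q.out⁻¹ (1 : F))

lemma relTrace_apply (P : Subgroup G) (a : MonoidAlgebra F G) :
    relTrace F P a = ∑ q : G ⧸ P, single q.out (1 : F) * a * single q.out⁻¹ 1 := by
  simp [relTrace, LinearMap.sum_apply, mul_assoc]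

lemma relTrace_mul_of_mem_center (P : Subgroup G) (a : MonoidAlgebra F G) {z : MonoidAlgebra F G}
    (hz : z ∈ Subalgebra.center F (MonoidAlgebra F G)) :
    relTrace F P (a * z) = relTrace F P a * z := by
  rw [Subalgebra.mem_center_iff] at hz
  simp only [relTrace_apply, Finset.sum_mul]
  refine Finset.sum_congr rfl fun q _ => ?_
  rw [← mul_assoc _ a z, hz, hz, mul_assoc z]

lemma mapDomain_relTrace (P : Subgroup G) [P.Normal] (a : MonoidAlgebra F G) :
    mapDomainAlgHom F F (QuotientGroup.mk' P) (relTrace F P a) =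
      ∑ q : G ⧸ P, single q (1 : F) * mapDomainAlgHom F F (QuotientGroup.mk' P) a *
        single q⁻¹ 1 := by
  simp only [relTrace_apply, map_sum, map_mul]
  refine Finset.sum_congr rfl fun q _ => ?_
  simp [mapDomainAlgHom_apply]

lemma mapDomain_relTrace_mul_eq_zero (P : Subgroup G) [P.Normal] (a : MonoidAlgebra F G)
    {z : MonoidAlgebra F G} (hz : z ∈ Subalgebra.center F (MonoidAlgebra F G))
    (hn : IsNilpotent z) :
    mapDomainAlgHom F F (QuotientGroup.mk' P) (relTrace F P (a * z)) = 0 := by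
  rw [mapDomain_relTrace]
  apply sum_conj_eq_zero_of_isNilpotent
  rw [Subalgebra.mem_center_iff] at hz
  exact (Commute.isNilpotent_mul_left (hz a) hn).map _

lemma coeff_classSum (K : ConjClasses G) (y : G) :
    (classSum F K).coeff y = if y ∈ K.carrier then 1 else 0 := by
  simp only [classSum, coeff_sum, Finsupp.coe_finsetSum, Finset.sum_apply]
  rw [Finset.sum_eq_single y]
  · split_ifs <;> simp
  · intro b _ hb
    split_ifs <;> simp [hb]
  · simp

lemma card_setOf_conj_eq (x y : G) :
    Nat.card {g : G | g * x * g⁻¹ = y} =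
      if IsConj x y then Nat.card (Subgroup.centralizer {x}) else 0 := by
  split_ifs with h
  · obtain ⟨k, rfl⟩ := isConj_iff.1 h
    refine Nat.card_congr ((Equiv.mulLeft k⁻¹).subtypeEquiv fun g => ?_)
    simp only [Set.mem_ofPred_eq, Equiv.coe_mulLeft, Subgroup.mem_centralizer_singleton_iff]
    constructor
    · intro h
      have : g * x = k * x * k⁻¹ * g := by rw [← h]; group
      rw [mul_assoc, this]; group
    · intro h
      have : g * x = k * (k⁻¹ * g * x) := by group
      rw [this, h]; group
  · have : {g : G | g * x * g⁻¹ = y} = ∅ := by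
      ext g
      simp only [Set.mem_ofPred_eq, Set.mem_empty_iff_false, iff_false]
      exact fun hg => h (isConj_iff.2 ⟨g, hg⟩)
    simp [this]

lemma card_transversal_conj_eq {P : Subgroup G} (hP : P ≤ Subgroup.center G) (x y : G) :
    Nat.card {q : G ⧸ P | q.out * x * q.out⁻¹ = y} =
      if IsConj x y then P.relIndex (Subgroup.centralizer {x}) else 0 := by
  have hpre : (QuotientGroup.mk : G → G ⧸ P) ⁻¹' {q | q.out * x * q.out⁻¹ = y} =
      {g : G | g * x * g⁻¹ = y} := by
    ext g
    obtain ⟨u, hu⟩ := QuotientGroup.mk_out_eq_mul P g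
    have hux := Subgroup.mem_center_iff.1 (hP u.2) x
    have : g * u * x * (g * u)⁻¹ = g * x * g⁻¹ := by
      rw [mul_assoc g, ← hux]; group
    simp only [Set.mem_preimage, Set.mem_ofPred_eq, hu, this]
  have h1 := QuotientGroup.card_preimage_mk P {q | q.out * x * q.out⁻¹ = y}
  rw [hpre, card_setOf_conj_eq] at h1
  have h2 := Subgroup.card_mul_index (P.subgroupOf (Subgroup.centralizer {x}))
  rw [Nat.card_congr (Subgroup.subgroupOfEquivOfLe
    (le_centralizer_of_le_center hP {x})).toEquiv] at h2
  refine Nat.eq_of_mul_eq_mul_left (Nat.card_pos (α := P)) ?_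
  rw [← h1]
  split_ifs with h
  · exact h2.symm
  · simp

lemma relTrace_single {P : Subgroup G} (hP : P ≤ Subgroup.center G) (x : G) :
    relTrace F P (single x 1) =
      (P.relIndex (Subgroup.centralizer {x}) : F) • classSum F (ConjClasses.mk x) := by
  ext y
  have h := card_transversal_conj_eq hP x y
  rw [Nat.card_eq_fintype_card, Fintype.card_ofFinset] at h
  simp only [relTrace_apply, single_mul_single, coeff_sum, Finsupp.coe_finsetSum,
    Finset.sum_apply, coeff_smul, Finsupp.smul_apply, coeff_classSum, mul_one, coeff_single,
    Finsupp.single_apply, Finset.sum_boole, ConjClasses.mem_carrier_iff_mk_eq,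
    ConjClasses.mk_eq_mk_iff_isConj]
  have h' : (Finset.univ.filter fun q : G ⧸ P => q.out * x * q.out⁻¹ = y).card =
      if IsConj x y then P.relIndex (Subgroup.centralizer {x}) else 0 := by
    rw [← h]; rfl
  rw [h']
  by_cases hxy : IsConj x y
  · rw [if_pos hxy, if_pos hxy.symm, smul_eq_mul, mul_one]
  · rw [if_neg hxy, if_neg (mt IsConj.symm hxy), smul_zero, Nat.cast_zero]

lemma exists_not_dvd_relIndex_of_isClassDefectGroup {p : ℕ} [Fact p.Prime] {P Q : Subgroup G}
    (hP : IsPGroup p P) (hQ : Q ≤ P) {K : ConjClasses G}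
    (h : IsClassDefectGroup p Q K) :
    ∃ x, ConjClasses.mk x = K ∧ ¬ p ∣ P.relIndex (Subgroup.centralizer {x}) := by
  obtain ⟨x, hx, S, rfl⟩ := h
  refine ⟨x, ConjClasses.mem_carrier_iff_mk_eq.1 hx, ?_⟩
  have hS : P.subgroupOf (Subgroup.centralizer {x}) = S := by
    refine S.is_maximal' ?_ ?_
    · exact hP.comap_of_injective _ (Subgroup.subtype_injective _)
    · exact Subgroup.map_le_iff_le_comap.1 hQ
  rw [Subgroup.relIndex, hS]
  exact S.not_dvd_index

lemma classSum_mem_classIdealLE {p : ℕ} [Fact p.Prime] {P : Subgroup G}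
    (hP : IsPGroup p P) (hc : P ≤ Subgroup.center G) {x : G}
    (h : ¬ p ∣ P.relIndex (Subgroup.centralizer {x})) :
    classSum F (ConjClasses.mk x) ∈ classIdealLE F p P :=
  le_iSup₂ (f := fun Q (_ : Q ≤ P) => classIdeal F p Q) P le_rfl <|
    Submodule.subset_span ⟨_, isClassDefectGroup_mk_of_not_dvd_relIndex hP hc h, rfl⟩

lemma classIdealLE_eq_span {p : ℕ} [Fact p.Prime] {P : Subgroup G}
    (hP : IsPGroup p P) (hc : P ≤ Subgroup.center G) :
    classIdealLE F p P = Submodule.span F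
      ((fun x => classSum F (ConjClasses.mk x)) ''
        {x | ¬ p ∣ P.relIndex (Subgroup.centralizer {x})}) := by
  refine le_antisymm (iSup₂_le fun Q hQ => Submodule.span_mono ?_) (Submodule.span_le.2 ?_)
  · rintro _ ⟨K, hK, rfl⟩
    obtain ⟨x, rfl, hx⟩ := exists_not_dvd_relIndex_of_isClassDefectGroup hP hQ hK
    exact ⟨x, hx, rfl⟩
  · rintro _ ⟨x, hx, rfl⟩
    exact classSum_mem_classIdealLE hP hc hx

lemma relTrace_mem_classIdealLE {p : ℕ} [Fact p.Prime] [CharP F p] {P : Subgroup G}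
    (hP : IsPGroup p P) (hc : P ≤ Subgroup.center G) (a : MonoidAlgebra F G) :
    relTrace F P a ∈ classIdealLE F p P := by
  induction a using MonoidAlgebra.induction_linear with
  | zero => simp
  | add a b ha hb => rw [map_add]; exact add_mem ha hb
  | single x r =>
    rw [← mul_one r, ← smul_eq_mul, ← smul_single, map_smul, relTrace_single hc]
    refine Submodule.smul_mem _ _ ?_
    by_cases h : p ∣ P.relIndex (Subgroup.centralizer {x})
    · rw [(CharP.cast_eq_zero_iff F p _).2 h, zero_smul]
      exact zero_mem _
    · exact Submodule.smul_mem _ _ (classSum_mem_classIdealLE hP hc h)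

lemma exists_mul_coprime_orderOf {p : ℕ} [Fact p.Prime] {P : Subgroup G}
    (hP : IsPGroup p P) (hc : P ≤ Subgroup.center G) {x : G}
    (h : ¬ p ∣ P.relIndex (Subgroup.centralizer {x})) :
    ∃ u ∈ P, ∃ r : G, x = u * r ∧ (orderOf r).Coprime p := by
  set n := P.relIndex (Subgroup.centralizer {x}) with hn
  obtain ⟨k, hk⟩ := IsPGroup.iff_card.1 hP
  have hcop : n.Coprime p := ((Fact.out : p.Prime).coprime_iff_not_dvd.2 h).symm
  have hnP : n.Coprime (p ^ k) := hcop.pow_right k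
  have hPn : P.Normal := normal_of_le_center hc
  have hxn : x ^ n ∈ P := by
    have := (P.subgroupOf (Subgroup.centralizer {x})).pow_index_mem
      ⟨x, Subgroup.mem_centralizer_singleton_iff.2 rfl⟩
    rwa [Subgroup.mem_subgroupOf] at this
  have hb : (n : ℤ) * n.gcdA (p ^ k) + (p ^ k : ℕ) * n.gcdB (p ^ k) = 1 := by
    rw [← Nat.gcd_eq_gcd_ab, hnP, Nat.cast_one]
  refine ⟨x ^ ((n : ℤ) * n.gcdA (p ^ k)), ?_, x ^ (((p ^ k : ℕ) : ℤ) * n.gcdB (p ^ k)), ?_, ?_⟩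
  · rw [zpow_mul, zpow_natCast]
    exact P.zpow_mem hxn _
  · rw [← zpow_add, hb, zpow_one]
  · refine Nat.Coprime.coprime_dvd_left (orderOf_dvd_of_pow_eq_one ?_) hcop
    have h1 : (x ^ n) ^ (p ^ k) = 1 := by
      rw [← hk]
      exact congrArg Subtype.val (pow_card_eq_one' (x := (⟨x ^ n, hxn⟩ : P)))
    rw [← zpow_natCast, ← zpow_mul,
      show ((p ^ k : ℕ) : ℤ) * n.gcdB (p ^ k) * n = (n : ℤ) * (p ^ k : ℕ) * n.gcdB (p ^ k) by ring,
      zpow_mul, zpow_mul, zpow_natCast, zpow_natCast, h1, one_zpow]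

/-- The linear map `F[G/P] → FG` sending a coset to its `p`-regular element, if it has one,
and to zero otherwise. -/
noncomputable def regularLift (F : Type) [Field F] (p : ℕ) (P : Subgroup G) :
    MonoidAlgebra F (G ⧸ P) →ₗ[F] MonoidAlgebra F G :=
  (MonoidAlgebra.basis (G ⧸ P) F).constr F fun q =>
    if h : ∃ r : G, (r : G ⧸ P) = q ∧ (orderOf r).Coprime p then single h.choose 1 else 0

lemma regularLift_single_mk {p : ℕ} {P : Subgroup G}
    (hP : IsPGroup p P) (hc : P ≤ Subgroup.center G) {r : G} (hr : (orderOf r).Coprime p) :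
    regularLift F p P (single (r : G ⧸ P) 1) = single r 1 := by
  have h : ∃ s : G, (s : G ⧸ P) = r ∧ (orderOf s).Coprime p := ⟨r, rfl, hr⟩
  have hb : (single (r : G ⧸ P) 1 : MonoidAlgebra F (G ⧸ P)) = MonoidAlgebra.basis (G ⧸ P) F r := by
    simp [MonoidAlgebra.basis]
  rw [hb, regularLift, Module.Basis.constr_basis, dif_pos h,
    eq_of_coprime_orderOf_of_mk_eq hP hc h.choose_spec.2 hr h.choose_spec.1]

lemma regularLift_mapDomain_classSum {p : ℕ} {P : Subgroup G} [P.Normal]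
    (hP : IsPGroup p P) (hc : P ≤ Subgroup.center G) {u r : G} (hu : u ∈ P)
    (hr : (orderOf r).Coprime p) :
    regularLift F p P (mapDomainAlgHom F F (QuotientGroup.mk' P)
      (classSum F (ConjClasses.mk (u * r)))) =
      classSum F (ConjClasses.mk (u * r)) * single u⁻¹ 1 := by
  simp only [classSum, map_sum, Finset.sum_mul]
  refine Finset.sum_congr rfl fun y _ => ?_
  split_ifs with hy
  · rw [ConjClasses.mem_carrier_iff_mk_eq, ConjClasses.mk_eq_mk_iff_isConj, isConj_comm,
      isConj_iff] at hy
    obtain ⟨g, rfl⟩ := hy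
    have hg := Subgroup.mem_center_iff.1 (hc hu)
    have h1 : g * (u * r) * g⁻¹ = g * r * g⁻¹ * u := by
      rw [hg, ← mul_assoc g, hg g, mul_assoc, mul_assoc, mul_assoc]
    have hmk : QuotientGroup.mk' P (g * (u * r) * g⁻¹) = ((g * r * g⁻¹ : G) : G ⧸ P) := by
      rw [h1]
      exact QuotientGroup.mk_mul_of_mem _ hu
    have ho : (orderOf (g * r * g⁻¹)).Coprime p := by
      rwa [← MulAut.conj_apply, MulEquiv.orderOf_eq]
    rw [mapDomainAlgHom_apply, mapDomain_single, hmk, regularLift_single_mk hP hc ho,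
      single_mul_single, h1, mul_inv_cancel_right, mul_one]
  · simp

lemma map_jacobson_le_JZ {P : Subgroup G} (hc : P ≤ Subgroup.center G) :
    Submodule.map (mapDomainAlgHom F F P.subtype).toLinearMap
      ((Ideal.jacobson (⊥ : Ideal (MonoidAlgebra F P))).restrictScalars F) ≤ JZ F G := by
  rintro _ ⟨a, ha, rfl⟩
  have : Module.Finite F (MonoidAlgebra F P) := .of_basis (MonoidAlgebra.basis P F)
  have : IsArtinianRing (MonoidAlgebra F P) := IsArtinianRing.of_finite F _
  have hn : IsNilpotent a := isNilpotent_of_mem_jacobson_bot ha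
  have hz : mapDomainAlgHom F F P.subtype a ∈ Subalgebra.center F (MonoidAlgebra F G) := by
    clear ha hn
    induction a using MonoidAlgebra.induction_linear with
    | zero => simp
    | add a b ha hb => rw [map_add]; exact add_mem ha hb
    | single u r =>
      rw [Subalgebra.mem_center_iff]
      intro b
      rw [mapDomainAlgHom_apply, mapDomain_single]
      exact (single_commute (fun v => (Subgroup.mem_center_iff.1 (hc u.2) v).symm)
        (fun s => mul_comm r s) b).symm
  refine ⟨⟨_, hz⟩, mem_jacobson_bot_of_isNilpotent_of_commute ?_ fun y => mul_comm _ _, rfl⟩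
  obtain ⟨n, hn⟩ := hn.map (mapDomainAlgHom F F P.subtype)
  exact ⟨n, Subtype.ext hn⟩

lemma mem_center_and_isNilpotent_of_mem_JZ {z : MonoidAlgebra F G} (hz : z ∈ JZ F G) :
    z ∈ Subalgebra.center F (MonoidAlgebra F G) ∧ IsNilpotent z := by
  obtain ⟨w, hw, rfl⟩ := hz
  have : Module.Finite F (MonoidAlgebra F G) := .of_basis (MonoidAlgebra.basis G F)
  have : IsArtinianRing (Subalgebra.center F (MonoidAlgebra F G)) := IsArtinianRing.of_finite F _
  exact ⟨w.2, (isNilpotent_of_mem_jacobson_bot hw).map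
    (Subalgebra.center F (MonoidAlgebra F G)).val⟩

/-- An element of `I_{≤P}(G)` is congruent modulo `I_{≤P}(G) · J(FP)` to the lift of its image
in `F[G/P]`. -/
lemma sub_regularLift_mem {p : ℕ} [Fact p.Prime] [CharP F p] {P : Subgroup G} [P.Normal]
    (hP : IsPGroup p P) (hc : P ≤ Subgroup.center G) {a : MonoidAlgebra F G}
    (ha : a ∈ classIdealLE F p P) :
    a - regularLift F p P (mapDomainAlgHom F F (QuotientGroup.mk' P) a) ∈
      classIdealLE F p P * Submodule.map (mapDomainAlgHom F F P.subtype).toLinearMap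
        ((Ideal.jacobson (⊥ : Ideal (MonoidAlgebra F P))).restrictScalars F) := by
  rw [classIdealLE_eq_span hP hc] at ha
  induction ha using Submodule.span_induction with
  | zero => simp
  | add a b _ _ ha hb =>
    rw [map_add, map_add, add_sub_add_comm]
    exact add_mem ha hb
  | smul r a _ ha =>
    rw [map_smul, map_smul, ← smul_sub]
    exact Submodule.smul_mem _ r ha
  | mem a ha =>
    obtain ⟨x, hx, rfl⟩ := ha
    obtain ⟨u, hu, r, hxu, hr⟩ := exists_mul_coprime_orderOf hP hc hx
    have hK := classSum_mem_classIdealLE (F := F) hP hc hx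
    subst hxu
    dsimp only
    rw [regularLift_mapDomain_classSum hP hc hu hr]
    rw [← mul_one_sub]
    refine Submodule.mul_mem_mul hK ⟨_, one_sub_single_mem_jacobson hP hc ⟨u⁻¹, inv_mem hu⟩, ?_⟩
    rw [AlgHom.toLinearMap_apply, map_sub, map_one, mapDomainAlgHom_apply, mapDomain_single]
    rfl

end PassmanLemma

/-- **Passman's lemma.** If `P` is a central `p`-subgroup of the finite group `G`, then
`I_{≤P}(G) · J(Z(FG)) = I_{≤P}(G) · J(FP)`, where `J(FP)` is the Jacobson radical of the group
algebra of `P`, embedded into `FG`. -/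
theorem passman_lemma (F : Type) [Field F] [IsAlgClosed F] (G : Type) [Group G] [Fintype G]
    (p : ℕ) [Fact p.Prime] [CharP F p]
    (P : Subgroup G) (hP : IsPGroup p P) (hcentral : P ≤ Subgroup.center G) :
    classIdealLE F p P * JZ F G =
      classIdealLE F p P *
        Submodule.map (MonoidAlgebra.mapDomainAlgHom F F P.subtype).toLinearMap
          ((Ideal.jacobson (⊥ : Ideal (MonoidAlgebra F ↥P))).restrictScalars F) := by
  have hPn : P.Normal := normal_of_le_center hcentral
  refine le_antisymm (Submodule.mul_le.2 fun a ha z hz => ?_)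
    (mul_le_mul_right (map_jacobson_le_JZ hcentral) _)
  obtain ⟨hzc, hzn⟩ := mem_center_and_isNilpotent_of_mem_JZ hz
  rw [classIdealLE_eq_span hP hcentral] at ha
  induction ha using Submodule.span_induction with
  | zero => simp
  | add a b _ _ ha hb => rw [add_mul]; exact add_mem ha hb
  | smul r a _ ha => rw [smul_mul_assoc]; exact Submodule.smul_mem _ r ha
  | mem a ha =>
    obtain ⟨x, hx, rfl⟩ := ha
    have hn : (P.relIndex (Subgroup.centralizer {x}) : F) ≠ 0 :=
      mt (CharP.cast_eq_zero_iff F p _).1 hx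
    have key := sub_regularLift_mem (F := F) hP hcentral
      (relTrace_mem_classIdealLE hP hcentral (MonoidAlgebra.single x 1 * z))
    rw [mapDomain_relTrace_mul_eq_zero P _ hzc hzn, map_zero, sub_zero,
      relTrace_mul_of_mem_center P _ hzc, relTrace_single hcentral, smul_mul_assoc] at key
    exact (Submodule.smul_mem_iff _ hn).1 key
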